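/- Let τ = ℕ with 0_τ = 0. Suppose S_x is a bar securing g : (ℕ → ℕ) → ℕ, and (S_n)_{n ∈ ℕ} is a family of bars such that for each n, S_n secures R_n : (ℕ → ℕ) → ℕ. Define S s := S_x s ∧ S_{g ŝ} s. Then S is a bar and S secures the functional fun α => R_{g α} α. (Securing step of the recursor case in the proof of Theorem 3.3.) -/

import Mathlib

/-- Extension of a finite sequence `s` by infinitely many copies of `z` (the "hat"). -/
def ext {τ : Type*} (z : τ) (s : List τ) : ℕ → τ := fun n => s.getD n z

/-- Concatenation `s * β` of a finite sequence with an infinite one. -/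
def cat {τ : Type*} (s : List τ) (β : ℕ → τ) : ℕ → τ :=
  fun n => if h : n < s.length then s[n] else β (n - s.length)

/-- `S` is a bar: decidable, monotone, and hit by every infinite sequence. -/
def IsBar {τ : Type*} (S : List τ → Prop) : Prop :=
  (∀ s, S s ∨ ¬ S s) ∧ (∀ s t : List τ, S s → S (s ++ t)) ∧
    (∀ α : ℕ → τ, ∃ n : ℕ, S ((List.range n).map α))

/-- `S` secures `Y`: whenever `S s` holds, `fun β => Y (s * β)` is constant. -/
def Secures {τ : Type*} (S : List τ → Prop) (Y : (ℕ → τ) → ℕ) : Prop :=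
  ∀ s, S s → ∀ β β' : ℕ → τ, Y (cat s β) = Y (cat s β')

/-- The general bar-recursion equation for the bar `S`. -/
def GenBR {τ σ : Type*} (S : List τ → Prop)
    (Δ : (List τ → σ) → (List τ → (τ → σ) → σ) → List τ → σ) : Prop :=
  ∀ G H s, (S s → Δ G H s = G s) ∧
    (¬ S s → Δ G H s = H s (fun x => Δ G H (s ++ [x])))

/-- Spector's bar-recursion equation for the stopping functional `Y`. -/
def SpectorBR {τ σ : Type*} (z : τ) (Y : (ℕ → τ) → ℕ)
    (ξ : (List τ → σ) → (List τ → (τ → σ) → σ) → List τ → σ) : Prop :=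
  ∀ G H s, (Y (ext z s) < s.length → ξ G H s = G s) ∧
    (s.length ≤ Y (ext z s) → ξ G H s = H s (fun x => ξ G H (s ++ [x])))

/-- The auxiliary functional `φ`. -/
def phi {τ σ : Type*} (G : List τ → σ) (H : List τ → (τ → σ) → σ) : ℕ → List τ → σ
  | 0 => G
  | n + 1 => fun s => H s (fun x => phi G H n (s ++ [x]))

/-- The functional `Ψ`, bar recursion for a constant stopping functional. -/
def psi {τ σ : Type*} (k : ℕ) (G : List τ → σ) (H : List τ → (τ → σ) → σ)
    (s : List τ) : σ :=
  if s.length > k then G s else phi G H (k + 1 - s.length) s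

theorem ext_append {τ : Type*} (z : τ) (s t : List τ) :
    ext z (s ++ t) = cat s (ext z t) := by
  funext n
  by_cases h : n < s.length
  · simp [ext, cat, h, List.getElem?_append_left]
  · simp [ext, cat, h, List.getElem?_append_right (not_lt.mp h)]

theorem ext_eq_cat {τ : Type*} (z : τ) (s : List τ) : ext z s = cat s (ext z []) := by
  simpa using ext_append z s []

theorem cat_map_range {τ : Type*} (α : ℕ → τ) (n : ℕ) :
    cat ((List.range n).map α) (fun k => α (n + k)) = α := by
  funext k
  by_cases h : k < n
  · simp [cat, h]
  · simp [cat, h, Nat.add_sub_cancel' (not_lt.mp h)]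

theorem IsBar.map_range_of_le {τ : Type*} {S : List τ → Prop} (hS : IsBar S) {α : ℕ → τ}
    {m n : ℕ} (hmn : m ≤ n) (h : S ((List.range m).map α)) : S ((List.range n).map α) := by
  obtain ⟨k, rfl⟩ := Nat.exists_eq_add_of_le hmn
  rw [List.range_add, List.map_append]
  exact hS.2.1 _ _ h

theorem Secures.cat_eq_ext {τ : Type*} {S : List τ → Prop} {Y : (ℕ → τ) → ℕ}
    (hY : Secures S Y) (z : τ) {s : List τ} (hs : S s) (β : ℕ → τ) :
    Y (cat s β) = Y (ext z s) := by
  rw [ext_eq_cat]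
  exact hY s hs _ _

/-- Securing step of the recursor case in the proof of Theorem 3.3 (`τ = ℕ`,
`0_τ = 0`): if `S_x` is a bar securing `g` and each `S_n` is a bar securing `R_n`,
then `S s := S_x s ∧ S_{g ŝ} s` is a bar securing `fun α => R (g α) α`. -/
theorem rec_case_bar (g : (ℕ → ℕ) → ℕ) (Sx : List ℕ → Prop)
    (hbarx : IsBar Sx) (hsecx : Secures Sx g)
    (S : ℕ → List ℕ → Prop) (R : ℕ → (ℕ → ℕ) → ℕ)
    (hbar : ∀ n, IsBar (S n)) (hsec : ∀ n, Secures (S n) (R n)) :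
    IsBar (fun s : List ℕ => Sx s ∧ S (g (ext 0 s)) s) ∧
    Secures (fun s : List ℕ => Sx s ∧ S (g (ext 0 s)) s)
      (fun α : ℕ → ℕ => R (g α) α) := by
  refine ⟨⟨fun s => em _, ?_, fun α => ?_⟩, ?_⟩
  · rintro s t ⟨hx, hs⟩
    refine ⟨hbarx.2.1 s t hx, ?_⟩
    rw [ext_append, hsecx.cat_eq_ext 0 hx]
    exact (hbar _).2.1 s t hs
  · obtain ⟨m, hm⟩ := hbarx.2.2 α
    obtain ⟨n, hn⟩ := (hbar (g α)).2.2 α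
    have hx := hbarx.map_range_of_le (le_max_left m n) hm
    refine ⟨max m n, hx, ?_⟩
    rw [← hsecx.cat_eq_ext 0 hx (fun k => α (max m n + k)), cat_map_range]
    exact (hbar _).map_range_of_le (le_max_right m n) hn
  · rintro s ⟨hx, hs⟩ β β'
    simp only [hsecx.cat_eq_ext 0 hx]
    exact hsec _ s hs β β'
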